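/- Let G be a finite simple graph such that the subgraph induced by the vertices of maximum degree is acyclic. Then for any t > Δ(G), every proper t-edge coloring of G can be transformed into a proper Δ(G)-edge coloring of G by a finite sequence of interchanges. -/

import Mathlib

attribute [local instance] Classical.propDecidable

variable {V : Type*}

/-- `f` is a proper `t`-edge coloring of `G`: edges get colors in `{1,…,t}` and
adjacent (distinct, sharing a vertex) edges get different colors. -/
def IsProperEdgeColoring (G : SimpleGraph V) (t : ℕ) (f : Sym2 V → ℕ) : Prop :=
  (∀ e ∈ G.edgeSet, f e ∈ Finset.Icc 1 t) ∧
  ∀ e₁ ∈ G.edgeSet, ∀ e₂ ∈ G.edgeSet, e₁ ≠ e₂ → (∃ v, v ∈ e₁ ∧ v ∈ e₂) → f e₁ ≠ f e₂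

/-- The two-colored subgraph `G_f(a,b)` induced by the edges colored `a` or `b`. -/
def twoColorSub (G : SimpleGraph V) (f : Sym2 V → ℕ) (a b : ℕ) : SimpleGraph V :=
  SimpleGraph.fromEdgeSet {e | e ∈ G.edgeSet ∧ (f e = a ∨ f e = b)}

/-- Swap the colors `a` and `b`. -/
def swapCol (a b c : ℕ) : ℕ := if c = a then b else if c = b then a else c

/-- The interchange (Kempe change) of colors `a,b` on the connected component of
`v` in the two-colored subgraph `G_f(a,b)`. -/
noncomputable def interchange (G : SimpleGraph V) (f : Sym2 V → ℕ) (a b : ℕ) (v : V) :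
    Sym2 V → ℕ :=
  fun e => if ∀ x ∈ e, (twoColorSub G f a b).Reachable v x then swapCol a b (f e) else f e

/-- One interchange step between colorings, using colors from `{1,…,t}`. -/
def KempeStep (G : SimpleGraph V) (t : ℕ) (f g : Sym2 V → ℕ) : Prop :=
  ∃ a ∈ Finset.Icc 1 t, ∃ b ∈ Finset.Icc 1 t, ∃ v, g = interchange G f a b v

/-- Kempe equivalence: transformability by a finite sequence of interchanges. -/
def KempeEquiv (G : SimpleGraph V) (t : ℕ) (f g : Sym2 V → ℕ) : Prop :=
  Relation.ReflTransGen (KempeStep G t) f g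

/-- The chromatic index: least `t` admitting a proper `t`-edge coloring. -/
noncomputable def chromaticIndex (G : SimpleGraph V) : ℕ :=
  sInf {t | ∃ f, IsProperEdgeColoring G t f}

/-- The set of colors appearing at `v` under `f`. -/
def colorsAt (G : SimpleGraph V) (f : Sym2 V → ℕ) (v : V) : Set ℕ :=
  {c | ∃ e ∈ G.edgeSet, v ∈ e ∧ f e = c}

section KempeChains

variable {G : SimpleGraph V} {t : ℕ} {f : Sym2 V → ℕ} {a b c : ℕ}

theorem mem_colorsAt_iff {v : V} :
    c ∈ colorsAt G f v ↔ ∃ u, G.Adj v u ∧ f s(v, u) = c := by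
  constructor
  · rintro ⟨e, he, hv, hc⟩
    obtain ⟨u, rfl⟩ := hv
    exact ⟨u, he, hc⟩
  · rintro ⟨u, hu, hc⟩
    exact ⟨s(v, u), hu, by simp, hc⟩

theorem SimpleGraph.Adj.color_mem_colorsAt {v u : V} (h : G.Adj v u) :
    f s(v, u) ∈ colorsAt G f v :=
  mem_colorsAt_iff.2 ⟨u, h, rfl⟩

theorem isProperEdgeColoring_iff :
    IsProperEdgeColoring G t f ↔
      (∀ v u, G.Adj v u → f s(v, u) ∈ Finset.Icc 1 t) ∧
      ∀ v u w, G.Adj v u → G.Adj v w → f s(v, u) = f s(v, w) → u = w := by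
  constructor
  · rintro ⟨h₁, h₂⟩
    refine ⟨fun v u h => h₁ _ h, fun v u w hu hw h => ?_⟩
    by_contra hne
    exact h₂ s(v, u) hu s(v, w) hw (by rwa [Ne, Sym2.congr_right])
      ⟨v, by simp, by simp⟩ h
  · rintro ⟨h₁, h₂⟩
    refine ⟨fun e => Sym2.ind (fun v u h => h₁ v u h) e, ?_⟩
    rintro e₁ he₁ e₂ he₂ hne ⟨v, ⟨u, rfl⟩, ⟨w, rfl⟩⟩ h
    exact hne (by rw [h₂ v u w he₁ he₂ h])

theorem IsProperEdgeColoring.color_mem (hf : IsProperEdgeColoring G t f) {v u : V}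
    (h : G.Adj v u) : f s(v, u) ∈ Finset.Icc 1 t :=
  hf.1 _ h

theorem IsProperEdgeColoring.eq_of_color_eq (hf : IsProperEdgeColoring G t f) {v u w : V}
    (hu : G.Adj v u) (hw : G.Adj v w) (h : f s(v, u) = f s(v, w)) : u = w :=
  (isProperEdgeColoring_iff.1 hf).2 v u w hu hw h

theorem swapCol_swapCol : swapCol a b (swapCol a b c) = c := by
  unfold swapCol; grind

theorem swapCol_left : swapCol a b a = b := by
  simp [swapCol]

theorem swapCol_right : swapCol a b b = a := by
  unfold swapCol; grind

theorem swapCol_of_ne (ha : c ≠ a) (hb : c ≠ b) : swapCol a b c = c := by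
  simp [swapCol, ha, hb]

theorem swapCol_injective : Function.Injective (swapCol a b) :=
  Function.LeftInverse.injective (g := swapCol a b) fun _ => swapCol_swapCol

theorem swapCol_mem_Icc (ha : a ∈ Finset.Icc 1 t) (hb : b ∈ Finset.Icc 1 t)
    (hc : c ∈ Finset.Icc 1 t) : swapCol a b c ∈ Finset.Icc 1 t := by
  unfold swapCol; split_ifs <;> assumption

theorem twoColorSub_adj {v u : V} :
    (twoColorSub G f a b).Adj v u ↔ G.Adj v u ∧ (f s(v, u) = a ∨ f s(v, u) = b) := by
  simp only [twoColorSub, SimpleGraph.fromEdgeSet_adj, Set.mem_ofPred_eq,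
    SimpleGraph.mem_edgeSet]
  exact ⟨fun h => h.1, fun h => ⟨h, h.1.ne⟩⟩

theorem interchange_apply {v w u : V} (h : G.Adj w u) :
    interchange G f a b v s(w, u) =
      if (twoColorSub G f a b).Reachable v w then swapCol a b (f s(w, u))
      else f s(w, u) := by
  simp only [interchange, Sym2.mem_iff, forall_eq_or_imp, forall_eq]
  by_cases hab : f s(w, u) = a ∨ f s(w, u) = b
  · have hadj := (twoColorSub_adj.2 ⟨h, hab⟩).reachable
    have : (twoColorSub G f a b).Reachable v w → (twoColorSub G f a b).Reachable v u :=
      fun h' => h'.trans hadj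
    by_cases hw : (twoColorSub G f a b).Reachable v w <;> simp [hw, this]
  · rw [not_or] at hab
    simp [swapCol_of_ne hab.1 hab.2]

theorem mem_colorsAt_interchange {v w : V} :
    c ∈ colorsAt G (interchange G f a b v) w ↔
      if (twoColorSub G f a b).Reachable v w then swapCol a b c ∈ colorsAt G f w
      else c ∈ colorsAt G f w := by
  simp only [mem_colorsAt_iff]
  split_ifs with hw
  · refine exists_congr fun u => and_congr_right fun hu => ?_
    rw [interchange_apply hu, if_pos hw]
    exact ⟨fun h => by rw [← h, swapCol_swapCol], fun h => by rw [h, swapCol_swapCol]⟩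
  · refine exists_congr fun u => and_congr_right fun hu => ?_
    rw [interchange_apply hu, if_neg hw]

theorem mem_colorsAt_interchange_of_ne {v w : V} (ha : c ≠ a) (hb : c ≠ b) :
    c ∈ colorsAt G (interchange G f a b v) w ↔ c ∈ colorsAt G f w := by
  rw [mem_colorsAt_interchange, swapCol_of_ne ha hb, ite_self]

theorem IsProperEdgeColoring.isProperEdgeColoring_interchange (hf : IsProperEdgeColoring G t f)
    (ha : a ∈ Finset.Icc 1 t) (hb : b ∈ Finset.Icc 1 t) (v : V) :
    IsProperEdgeColoring G t (interchange G f a b v) := by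
  rw [isProperEdgeColoring_iff]
  refine ⟨fun w u h => ?_, fun w u u' h h' he => ?_⟩
  · rw [interchange_apply h]
    split_ifs
    · exact swapCol_mem_Icc ha hb (hf.color_mem h)
    · exact hf.color_mem h
  · rw [interchange_apply h, interchange_apply h'] at he
    split_ifs at he
    · exact hf.eq_of_color_eq h h' (swapCol_injective he)
    · exact hf.eq_of_color_eq h h' he

/-- A connected component of a two-colored subgraph has at most two end vertices. -/
theorem IsProperEdgeColoring.eq_of_three_ends [Finite V] (hf : IsProperEdgeColoring G t f)
    {v x y z : V} (hx : (twoColorSub G f a b).Reachable v x)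
    (hy : (twoColorSub G f a b).Reachable v y) (hz : (twoColorSub G f a b).Reachable v z)
    (hx' : a ∉ colorsAt G f x ∨ b ∉ colorsAt G f x)
    (hy' : a ∉ colorsAt G f y ∨ b ∉ colorsAt G f y)
    (hz' : a ∉ colorsAt G f z ∨ b ∉ colorsAt G f z) (hxy : x ≠ y) (hxz : x ≠ z) :
    y = z := by
  by_contra hyz
  have := Fintype.ofFinite V
  set C := (twoColorSub G f a b).connectedComponentMk v
  have hconn := C.connected_toSimpleGraph
  set H := C.toSimpleGraph
  have hadj : ∀ u w : C, H.Adj u w → G.Adj u w ∧ (f s((u : V), w) = a ∨ f s((u : V), w) = b) :=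
    fun u w h => twoColorSub_adj.1 h
  have hdeg : ∀ u : C, H.degree u ≤ ((({a, b} : Finset ℕ)).filter (· ∈ colorsAt G f u)).card := by
    intro u
    rw [← SimpleGraph.card_neighborFinset_eq_degree]
    refine Finset.card_le_card_of_injOn (fun w => f s((u : V), w)) ?_ ?_
    · intro w hw
      have hw' := hadj u w (by simpa using hw)
      simpa using ⟨hw'.2, hw'.1.color_mem_colorsAt⟩
    · intro w hw w' hw' h
      exact Subtype.ext (hf.eq_of_color_eq (hadj u w (by simpa using hw)).1
        (hadj u w' (by simpa using hw')).1 h)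
  have hdeg2 : ∀ u : C, H.degree u ≤ 2 := fun u =>
    ((hdeg u).trans (Finset.card_filter_le _ _)).trans Finset.card_le_two
  have hdeg1 : ∀ u : C, a ∉ colorsAt G f u ∨ b ∉ colorsAt G f u → H.degree u ≤ 1 := by
    intro u hu
    refine (hdeg u).trans (Finset.card_le_one.2 ?_)
    simp only [Finset.mem_filter, Finset.mem_insert, Finset.mem_singleton]
    grind
  have mem : ∀ {u}, (twoColorSub G f a b).Reachable v u → u ∈ C := fun h =>
    SimpleGraph.ConnectedComponent.sound h.symm
  let S : Finset C := {⟨x, mem hx⟩, ⟨y, mem hy⟩, ⟨z, mem hz⟩}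
  have hS : S.card = 3 := Finset.card_eq_three.2 ⟨_, _, _, by simpa using hxy,
    by simpa using hxz, by simpa using hyz, rfl⟩
  have hsum : ∑ u, H.degree u + ∑ u : C, (if u ∈ S then 1 else 0) ≤ ∑ _u : C, 2 := by
    rw [← Finset.sum_add_distrib]
    refine Finset.sum_le_sum fun u _ => ?_
    split_ifs with hu
    · have : a ∉ colorsAt G f u ∨ b ∉ colorsAt G f u := by
        simp only [S, Finset.mem_insert, Finset.mem_singleton] at hu
        rcases hu with rfl | rfl | rfl <;> assumption
      have := hdeg1 u this
      omega
    · exact hdeg2 u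
  have hedge := hconn.card_vert_le_card_edgeSet_add_one
  rw [H.sum_degrees_eq_twice_card_edges, Finset.sum_ite_mem, Finset.univ_inter] at hsum
  rw [Nat.card_eq_fintype_card, Nat.card_eq_fintype_card, ← SimpleGraph.edgeFinset_card] at hedge
  simp only [Finset.sum_const, hS, Finset.card_univ, smul_eq_mul] at hsum
  omega

/-- The set of vertices incident with an edge of color `c`. -/
def colorSupport (G : SimpleGraph V) (f : Sym2 V → ℕ) (c : ℕ) : Set V :=
  {v | c ∈ colorsAt G f v}

theorem IsProperEdgeColoring.ncard_colorSupport_interchange_le [Finite V]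
    (hf : IsProperEdgeColoring G t f) {v y : V}
    (hy : (twoColorSub G f a b).Reachable v y) (hya : a ∈ colorsAt G f y)
    (hyb : b ∉ colorsAt G f y) :
    (colorSupport G (interchange G f a b v) a).ncard ≤ (colorSupport G f a).ncard := by
  rw [Set.ncard_le_ncard_iff_ncard_sdiff_le_ncard_sdiff]
  have h₁ : (colorSupport G (interchange G f a b v) a \ colorSupport G f a).ncard ≤ 1 := by
    rw [Set.ncard_le_one]
    rintro u ⟨hu, hu'⟩ w ⟨hw, hw'⟩
    simp only [colorSupport, Set.mem_ofPred_eq, mem_colorsAt_interchange] at hu hu' hw hw'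
    split_ifs at hu hw <;> try contradiction
    exact hf.eq_of_three_ends hy ‹_› ‹_› (.inr hyb) (.inl hu') (.inl hw')
      (by rintro rfl; exact hu' hya) (by rintro rfl; exact hw' hya)
  refine h₁.trans ((Set.ncard_pos (Set.toFinite _)).2 ⟨y, hya, ?_⟩)
  simp [colorSupport, mem_colorsAt_interchange, hy, swapCol_left, hyb]

theorem IsProperEdgeColoring.ncard_colorSupport_interchange_lt [Finite V]
    (hf : IsProperEdgeColoring G t f) {v y z : V} (hyz : y ≠ z)
    (hy : (twoColorSub G f a b).Reachable v y) (hya : a ∈ colorsAt G f y)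
    (hyb : b ∉ colorsAt G f y) (hz : (twoColorSub G f a b).Reachable v z)
    (hza : a ∈ colorsAt G f z) (hzb : b ∉ colorsAt G f z) :
    (colorSupport G (interchange G f a b v) a).ncard < (colorSupport G f a).ncard := by
  refine Set.ncard_lt_ncard (Set.ssubset_iff_exists.2 ⟨fun u hu => ?_, y, hya, ?_⟩)
  · by_contra hu'
    simp only [colorSupport, Set.mem_ofPred_eq, mem_colorsAt_interchange] at hu hu'
    split_ifs at hu <;> try contradiction
    have := hf.eq_of_three_ends ‹_› hy hz (.inl hu') (.inr hyb) (.inr hzb)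
      (by rintro rfl; exact hu' hya) (by rintro rfl; exact hu' hza)
    exact hyz this
  · simp [colorSupport, mem_colorsAt_interchange, hy, swapCol_left, hyb]


/-- The relation between consecutive end vertices of a Vizing fan centered at `x`: the edge `xz`
has a color different from `t` that is missing at `y`. -/
def FanStep (G : SimpleGraph V) (t : ℕ) (f : Sym2 V → ℕ) (x y z : V) : Prop :=
  G.Adj x z ∧ f s(x, z) ≠ t ∧ f s(x, z) ∉ colorsAt G f y

/-- Some sequence of interchanges decreases the number of vertices incident with color `t`. -/
def Improvable (G : SimpleGraph V) (t : ℕ) (f : Sym2 V → ℕ) : Prop :=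
  ∃ g, KempeEquiv G t f g ∧ IsProperEdgeColoring G t g ∧
    (colorSupport G g t).ncard < (colorSupport G f t).ncard

theorem KempeEquiv.improvable {g : Sym2 V → ℕ} (h : KempeEquiv G t f g)
    (hle : (colorSupport G g t).ncard ≤ (colorSupport G f t).ncard) (hg : Improvable G t g) :
    Improvable G t f := by
  obtain ⟨g', h', hp, hlt⟩ := hg
  exact ⟨g', h.trans h', hp, hlt.trans_le hle⟩

theorem kempeEquiv_interchange (ha : a ∈ Finset.Icc 1 t) (hb : b ∈ Finset.Icc 1 t) (v : V) :
    KempeEquiv G t f (interchange G f a b v) :=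
  .single ⟨a, ha, b, hb, v, rfl⟩

theorem KempeEquiv.mono {s : ℕ} {g : Sym2 V → ℕ} (hst : s ≤ t) (h : KempeEquiv G s f g) :
    KempeEquiv G t f g := by
  refine Relation.ReflTransGen.mono ?_ _ _ h
  rintro f g ⟨a, ha, b, hb, v, rfl⟩
  exact ⟨a, Finset.Icc_subset_Icc_right hst ha, b, Finset.Icc_subset_Icc_right hst hb, v, rfl⟩

theorem Relation.ReflTransGen.exists_nodup_isChain {α : Type*} {r : α → α → Prop} {x y : α}
    (h : Relation.ReflTransGen r x y) :
    ∃ l : List α, (x :: l).IsChain r ∧ (x :: l).Nodup ∧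
      (x :: l).getLast (List.cons_ne_nil _ _) = y := by
  induction h using Relation.ReflTransGen.head_induction_on with
  | refl => exact ⟨[], by simp⟩
  | @head x z hxz _ ih =>
    obtain ⟨l, hl, hnd, hlast⟩ := ih
    by_cases hx : x ∈ z :: l
    · obtain ⟨l₁, l₂, h⟩ := List.append_of_mem hx
      refine ⟨l₂, ?_, ?_, ?_⟩
      · rw [h] at hl
        exact hl.right_of_append
      · rw [h] at hnd
        exact hnd.of_append_right
      · simp only [h] at hlast
        rwa [List.getLast_append_of_ne_nil _ (List.cons_ne_nil _ _)] at hlast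
    · exact ⟨z :: l, List.isChain_cons_cons.2 ⟨hxz, hl⟩, List.nodup_cons.2 ⟨hx, hnd⟩, by
        rwa [List.getLast_cons_cons]⟩

theorem adj_of_fan {x y z : V} (hxy : G.Adj x y)
    (h : Relation.ReflTransGen (FanStep G t f x) y z) : G.Adj x z := by
  cases h with
  | refl => exact hxy
  | tail _ h => exact h.1

/-- Color `t` can be moved from the first to the last edge of a fan. -/
theorem IsProperEdgeColoring.exists_shift [Finite V] {x z : V} (l : List V)
    {f : Sym2 V → ℕ} (hf : IsProperEdgeColoring G t f) {y : V} (hxy : G.Adj x y)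
    (hy : f s(x, y) = t) (hl : (y :: l).IsChain (FanStep G t f x)) (hnd : (y :: l).Nodup)
    (hz : (y :: l).getLast (List.cons_ne_nil _ _) = z) :
    ∃ g, KempeEquiv G t f g ∧ IsProperEdgeColoring G t g ∧
      (colorSupport G g t).ncard ≤ (colorSupport G f t).ncard ∧ g s(x, z) = t ∧
      ∀ c, c ∉ colorsAt G f x → ∀ w, c ∈ colorsAt G g w ↔ c ∈ colorsAt G f w := by
  induction l generalizing f y with
  | nil =>
    obtain rfl : y = z := by simpa using hz
    exact ⟨f, .refl, hf, le_rfl, hy, fun _ _ _ => Iff.rfl⟩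
  | cons u l ih =>
    rw [List.isChain_cons_cons] at hl
    obtain ⟨⟨hxu, hut, huy⟩, hl⟩ := hl
    rw [List.getLast_cons_cons] at hz
    have ht : t ∈ Finset.Icc 1 t := hy ▸ hf.color_mem hxy
    have hu := hf.color_mem hxu
    have hxy_reach : (twoColorSub G f t (f s(x, u))).Reachable x y :=
      (twoColorSub_adj.2 ⟨hxy, .inl hy⟩).reachable
    have hty : t ∈ colorsAt G f y := mem_colorsAt_iff.2 ⟨x, hxy.symm, by rwa [Sym2.eq_swap]⟩
    set g := interchange G f t (f s(x, u)) x with hg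
    have hgx : ∀ w, G.Adj x w → g s(x, w) = swapCol t (f s(x, u)) (f s(x, w)) := fun w hw => by
      rw [hg, interchange_apply hw, if_pos (SimpleGraph.Reachable.refl _)]
    have hgo : ∀ c w, c ≠ t → c ≠ f s(x, u) → (c ∈ colorsAt G g w ↔ c ∈ colorsAt G f w) :=
      fun c w h₁ h₂ => mem_colorsAt_interchange_of_ne h₁ h₂
    have hchain : (u :: l).IsChain (FanStep G t g x) := by
      refine hl.imp_of_mem_tail_imp fun p q _ hq ⟨hxq, hqt, hqp⟩ => ?_
      have hqu : f s(x, q) ≠ f s(x, u) := fun h =>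
        (List.nodup_cons.1 hnd.of_cons).1 (hf.eq_of_color_eq hxq hxu h ▸ hq)
      have hgq : g s(x, q) = f s(x, q) := by rw [hgx q hxq, swapCol_of_ne hqt hqu]
      exact ⟨hxq, by rwa [hgq], by rwa [hgq, hgo _ _ hqt hqu]⟩
    obtain ⟨g', hgg', hg', hle, hgz, hcol⟩ := ih (hf.isProperEdgeColoring_interchange ht hu x) hxu
      (by rw [← hg, hgx u hxu, swapCol_right]) hchain hnd.of_cons hz
    refine ⟨g', (kempeEquiv_interchange ht hu x).trans hgg', hg',
      hle.trans (hf.ncard_colorSupport_interchange_le hxy_reach hty huy), hgz, fun c hc w => ?_⟩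
    have hct : c ≠ t := by
      rintro rfl
      exact hc (mem_colorsAt_iff.2 ⟨y, hxy, hy⟩)
    have hcu : c ≠ f s(x, u) := by
      rintro rfl
      exact hc hxu.color_mem_colorsAt
    rw [hcol c (by rwa [hgo c x hct hcu]), hgo c w hct hcu]

theorem IsProperEdgeColoring.exists_shift_of_fan [Finite V] (hf : IsProperEdgeColoring G t f)
    {x y z : V} (hxy : G.Adj x y) (hy : f s(x, y) = t)
    (h : Relation.ReflTransGen (FanStep G t f x) y z) :
    ∃ g, KempeEquiv G t f g ∧ IsProperEdgeColoring G t g ∧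
      (colorSupport G g t).ncard ≤ (colorSupport G f t).ncard ∧ g s(x, z) = t ∧
      ∀ c, c ∉ colorsAt G f x → ∀ w, c ∈ colorsAt G g w ↔ c ∈ colorsAt G f w := by
  obtain ⟨l, hl, hnd, hz⟩ := h.exists_nodup_isChain
  exact hf.exists_shift l hxy hy hl hnd hz

theorem IsProperEdgeColoring.improvable_of_fan [Finite V] (hf : IsProperEdgeColoring G t f)
    {x y z : V} (hxy : G.Adj x y) (hy : f s(x, y) = t)
    (h : Relation.ReflTransGen (FanStep G t f x) y z) (hc : c ∈ Finset.Icc 1 t)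
    (hcx : c ∉ colorsAt G f x) (hcz : c ∉ colorsAt G f z) : Improvable G t f := by
  obtain ⟨g, hfg, hg, hle, hgz, hcol⟩ := hf.exists_shift_of_fan hxy hy h
  have hxz := adj_of_fan hxy h
  have ht : t ∈ Finset.Icc 1 t := hy ▸ hf.color_mem hxy
  refine ⟨_, hfg.trans (kempeEquiv_interchange ht hc x),
    hg.isProperEdgeColoring_interchange ht hc x, ?_⟩
  exact (hg.ncard_colorSupport_interchange_lt hxz.ne (.refl _) (mem_colorsAt_iff.2 ⟨z, hxz, hgz⟩)
    (by rwa [hcol c hcx]) (twoColorSub_adj.2 ⟨hxz, .inl hgz⟩).reachable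
    (mem_colorsAt_iff.2 ⟨x, hxz.symm, by rwa [Sym2.eq_swap]⟩)
    (by rwa [hcol c hcx])).trans_le hle

theorem IsProperEdgeColoring.improvable_of_not_reachable [Finite V]
    (hf : IsProperEdgeColoring G t f) {x y z : V} (hxy : G.Adj x y) (hy : f s(x, y) = t)
    (h : Relation.ReflTransGen (FanStep G t f x) y z) (ha : a ∈ Finset.Icc 1 t)
    (hb : b ∈ Finset.Icc 1 t) (hat : t ≠ a) (hbt : t ≠ b) (haz : a ∉ colorsAt G f z)
    (hbx : b ∉ colorsAt G f x) (hzx : ¬ (twoColorSub G f a b).Reachable z x) :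
    Improvable G t f := by
  set g := interchange G f a b z with hg
  have hgp : IsProperEdgeColoring G t g := hf.isProperEdgeColoring_interchange ha hb z
  have hsupp : colorSupport G g t = colorSupport G f t :=
    Set.ext fun w => mem_colorsAt_interchange_of_ne hat hbt
  have hgx : ∀ w, G.Adj x w → g s(x, w) = f s(x, w) := fun w hw => by
    rw [hg, interchange_apply hw, if_neg hzx]
  have hbx' : b ∉ colorsAt G g x := by
    rwa [hg, mem_colorsAt_interchange, if_neg hzx]
  have hgy : g s(x, y) = t := by rwa [hgx y hxy]
  refine (kempeEquiv_interchange ha hb z).improvable (congrArg Set.ncard hsupp).le ?_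
  by_contra hni
  have hmiss : ∀ u, Relation.ReflTransGen (FanStep G t g x) y u → b ∈ colorsAt G g u :=
    fun u hu => by_contra fun hbu => hni (hgp.improvable_of_fan hxy hgy hu hb hbx' hbu)
  have hfan : ∀ u, Relation.ReflTransGen (FanStep G t f x) y u →
      Relation.ReflTransGen (FanStep G t g x) y u := by
    intro u hu
    induction hu with
    | refl => exact .refl
    | @tail u w _ huw ih =>
      refine ih.tail ⟨huw.1, by rw [hgx w huw.1]; exact huw.2.1, ?_⟩
      rw [hgx w huw.1, hg, mem_colorsAt_interchange]
      have hb' : f s(x, w) ≠ b := fun h => hbx (h ▸ huw.1.color_mem_colorsAt)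
      by_cases ha' : f s(x, w) = a
      · have hbu := hmiss u ih
        rw [hg, mem_colorsAt_interchange, swapCol_right] at hbu
        have := huw.2.2
        rw [ha'] at this ⊢
        split_ifs at hbu ⊢ with hr
        · exact absurd hbu this
        · exact this
      · rw [swapCol_of_ne ha' hb', ite_self]
        exact huw.2.2
  have := hmiss z (hfan z h)
  rw [hg, mem_colorsAt_interchange, if_pos (.refl _), swapCol_right] at this
  exact haz this

theorem exists_missing_color [Fintype V] [DecidableRel G.Adj] {n : ℕ} {v : V}
    (hdeg : G.degree v ≤ n)
    (h : G.degree v < n ∨ n + 1 ∈ colorsAt G f v) :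
    ∃ c ∈ Finset.Icc 1 n, c ∉ colorsAt G f v := by
  by_contra! hall
  have key : ∀ m, (∀ c ∈ Finset.Icc 1 m, c ∈ colorsAt G f v) → m ≤ G.degree v := by
    intro m hm
    have : Finset.Icc 1 m ⊆ (G.neighborFinset v).image fun u => f s(v, u) := fun c hc => by
      simpa using mem_colorsAt_iff.1 (hm c hc)
    simpa using (Finset.card_le_card this).trans Finset.card_image_le
  rcases h with h | h
  · exact absurd (key n hall) (by omega)
  · refine absurd (key (n + 1) fun c hc => ?_) (by omega)
    rw [Finset.mem_Icc] at hc
    rcases hc.2.eq_or_lt with rfl | hlt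
    · exact h
    · exact hall c (Finset.mem_Icc.2 ⟨hc.1, by omega⟩)

theorem IsProperEdgeColoring.exists_fan_maxDegree [Fintype V] [DecidableRel G.Adj] {n : ℕ}
    (hf : IsProperEdgeColoring G (n + 1) f) (hn : G.maxDegree ≤ n) {x y : V} (hxy : G.Adj x y)
    (hy : f s(x, y) = n + 1) (hni : ¬ Improvable G (n + 1) f) :
    ∃ z, z ≠ y ∧ Relation.ReflTransGen (FanStep G (n + 1) f x) y z ∧
      G.degree z = G.maxDegree := by
  by_contra! hdeg
  have hle : ∀ v, G.degree v ≤ n := fun v => (G.degree_le_maxDegree v).trans hn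
  have hsub : Finset.Icc 1 n ⊆ Finset.Icc 1 (n + 1) := Finset.Icc_subset_Icc_right (by omega)
  have hne : ∀ c ∈ Finset.Icc 1 n, n + 1 ≠ c := fun c hc => by
    rw [Finset.mem_Icc] at hc; omega
  obtain ⟨b, hb, hbx⟩ := exists_missing_color (hle x)
    (.inr (mem_colorsAt_iff.2 ⟨y, hxy, hy⟩))
  have hmiss : ∀ z, Relation.ReflTransGen (FanStep G (n + 1) f x) y z →
      ∃ w, G.Adj x w ∧ f s(x, w) ∈ Finset.Icc 1 n ∧ f s(x, w) ∉ colorsAt G f z := by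
    intro z hz
    have : ∃ c ∈ Finset.Icc 1 n, c ∉ colorsAt G f z := by
      refine exists_missing_color (hle z) ?_
      by_cases hzy : z = y
      · subst hzy
        exact .inr (mem_colorsAt_iff.2 ⟨x, hxy.symm, by rwa [Sym2.eq_swap]⟩)
      · exact .inl (((G.degree_le_maxDegree z).lt_of_ne (hdeg z hzy hz)).trans_le hn)
    obtain ⟨c, hc, hcz⟩ := this
    have hcx : c ∈ colorsAt G f x := by
      by_contra hcx
      exact hni (hf.improvable_of_fan hxy hy hz (hsub hc) hcx hcz)
    obtain ⟨w, hw, rfl⟩ := mem_colorsAt_iff.1 hcx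
    exact ⟨w, hw, hc, hcz⟩
  choose! w hw using hmiss
  let F : Finset V := Finset.univ.filter (Relation.ReflTransGen (FanStep G (n + 1) f x) y)
  have hF : ∀ z, z ∈ F ↔ Relation.ReflTransGen (FanStep G (n + 1) f x) y z := by simp [F]
  have hyF : y ∈ F := (hF y).2 .refl
  obtain ⟨z₁, hz₁, z₂, hz₂, hz, heq⟩ := Finset.exists_ne_map_eq_of_card_lt_of_maps_to
    (Finset.card_erase_lt_of_mem hyF) (f := w) fun z hz => by
      have hz := (hF z).1 hz
      obtain ⟨h₁, h₂, h₃⟩ := hw z hz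
      refine Finset.mem_coe.2 (Finset.mem_erase.2 ⟨?_, (hF _).2 (hz.tail ⟨h₁, (hne _ h₂).symm, h₃⟩)⟩)
      intro h
      rw [h] at h₂
      exact hne _ h₂ hy.symm
  rw [hF] at hz₁ hz₂
  obtain ⟨h₁, h₂, h₃⟩ := hw z₁ hz₁
  obtain ⟨-, -, h₃'⟩ := hw z₂ hz₂
  rw [← heq] at h₃'
  have hr : ∀ z, Relation.ReflTransGen (FanStep G (n + 1) f x) y z →
      f s(x, w z₁) ∉ colorsAt G f z → (twoColorSub G f (f s(x, w z₁)) b).Reachable z x :=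
    fun z hz hcz => by_contra fun hzx => hni (hf.improvable_of_not_reachable hxy hy hz (hsub h₂)
      (hsub hb) (hne _ h₂) (hne _ hb) hcz hbx hzx)
  exact hz (hf.eq_of_three_ends (.refl x) (hr z₁ hz₁ h₃).symm (hr z₂ hz₂ h₃').symm (.inr hbx)
    (.inl h₃) (.inl h₃') (adj_of_fan hxy hz₁).ne (adj_of_fan hxy hz₂).ne)

/-- In a finite acyclic graph, no nonempty set of darts is closed under non-backtracking
continuation. -/
theorem SimpleGraph.IsAcyclic.exists_dart_no_continuation {W : Type*} [Finite W]
    {H : SimpleGraph W} (hH : H.IsAcyclic) {P : W → W → Prop} {u v : W} (huv : P u v)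
    (hadj : ∀ u v, P u v → H.Adj u v) : ∃ u v, P u v ∧ ∀ w, w ≠ u → ¬ P v w := by
  by_contra! hP
  have := Fintype.ofFinite W
  have key : ∀ n u v, P u v → ∃ (w : W) (h : H.Adj u v) (p : H.Walk v w), p.length = n ∧
      (SimpleGraph.Walk.cons h p).edges.IsChain (· ≠ ·) := by
    intro n
    induction n with
    | zero => exact fun u v huv => ⟨v, hadj u v huv, .nil, rfl, by simp⟩
    | succ n ih =>
      intro u v huv
      obtain ⟨w, hwu, hvw⟩ := hP u v huv
      obtain ⟨z, h, p, hp, hc⟩ := ih v w hvw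
      refine ⟨z, hadj u v huv, .cons h p, by simp [hp], ?_⟩
      rw [SimpleGraph.Walk.edges_cons, SimpleGraph.Walk.edges_cons, List.isChain_cons_cons,
        ← SimpleGraph.Walk.edges_cons h]
      refine ⟨fun he => hwu ?_, hc⟩
      rw [Sym2.eq_swap, Sym2.congr_right] at he
      exact he.symm
  obtain ⟨w, h, p, hp, hc⟩ := key (Fintype.card W) u v huv
  have := ((hH.isPath_iff_isChain _).2 hc).length_lt
  simp [hp] at this

theorem IsProperEdgeColoring.improvable_of_isAcyclic [Fintype V] [DecidableRel G.Adj] {n : ℕ}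
    (hac : (SimpleGraph.induce {v | G.degree v = G.maxDegree} G).IsAcyclic)
    (hf : IsProperEdgeColoring G (n + 1) f) (hn : G.maxDegree ≤ n)
    (hne : (colorSupport G f (n + 1)).Nonempty) : Improvable G (n + 1) f := by
  by_contra hni
  let P : V → V → Prop := fun u v => G.Adj u v ∧ ∃ g, KempeEquiv G (n + 1) f g ∧
    IsProperEdgeColoring G (n + 1) g ∧
    (colorSupport G g (n + 1)).ncard ≤ (colorSupport G f (n + 1)).ncard ∧ g s(u, v) = n + 1
  have hstep : ∀ u v, P u v → ∃ w, w ≠ u ∧ P v w ∧ G.degree w = G.maxDegree := by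
    rintro u v ⟨huv, g, hfg, hg, hle, hguv⟩
    rw [Sym2.eq_swap] at hguv
    obtain ⟨w, hwu, hfan, hdeg⟩ := hg.exists_fan_maxDegree hn huv.symm hguv
      fun hi => hni (hfg.improvable hle hi)
    obtain ⟨g', hgg', hg', hle', hgw, -⟩ := hg.exists_shift_of_fan huv.symm hguv hfan
    exact ⟨w, hwu, ⟨adj_of_fan huv.symm hfan, g', hfg.trans hgg', hg', hle'.trans hle, hgw⟩, hdeg⟩
  obtain ⟨u, hu⟩ := hne
  obtain ⟨v, huv, hcol⟩ := mem_colorsAt_iff.1 hu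
  obtain ⟨w, -, hvw, hw⟩ := hstep u v ⟨huv, f, .refl, hf, le_rfl, hcol⟩
  obtain ⟨z, -, hwz, hz⟩ := hstep v w hvw
  obtain ⟨u, v, huv, hend⟩ := hac.exists_dart_no_continuation
    (P := fun u v => P u v) (u := ⟨w, hw⟩) (v := ⟨z, hz⟩) hwz fun u v huv => huv.1
  obtain ⟨w, hwu, hvw, hw⟩ := hstep u v huv
  exact hend ⟨w, hw⟩ (fun h => hwu (congrArg Subtype.val h)) hvw

theorem IsProperEdgeColoring.exists_kempeEquiv_of_isAcyclic [Fintype V] [DecidableRel G.Adj]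
    {n : ℕ} (hac : (SimpleGraph.induce {v | G.degree v = G.maxDegree} G).IsAcyclic)
    (hf : IsProperEdgeColoring G (n + 1) f) (hn : G.maxDegree ≤ n) :
    ∃ g, IsProperEdgeColoring G n g ∧ KempeEquiv G (n + 1) f g := by
  induction hk : (colorSupport G f (n + 1)).ncard using Nat.strong_induction_on generalizing f with
  | _ k ih =>
    rcases (colorSupport G f (n + 1)).eq_empty_or_nonempty with h | h
    · refine ⟨f, isProperEdgeColoring_iff.2 ⟨fun v u huv => ?_, (isProperEdgeColoring_iff.1 hf).2⟩,
        .refl⟩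
      have := Finset.mem_Icc.1 (hf.color_mem huv)
      have hne : f s(v, u) ≠ n + 1 := fun he =>
        Set.notMem_empty v (h ▸ mem_colorsAt_iff.2 ⟨u, huv, he⟩)
      exact Finset.mem_Icc.2 ⟨this.1, by omega⟩
    · obtain ⟨g, hfg, hg, hlt⟩ := hf.improvable_of_isAcyclic hac hn h
      obtain ⟨g', hg', hgg'⟩ := ih _ (hk ▸ hlt) hg rfl
      exact ⟨g', hg', hfg.trans hgg'⟩

end KempeChains

/-- if the subgraph induced by the vertices of maximum degree is
acyclic, then for `t > Δ(G)` every proper `t`-edge coloring can be transformed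
by interchanges into a proper `Δ(G)`-edge coloring. -/
theorem reduce_to_maxDegree_of_acyclic [Fintype V] (G : SimpleGraph V)
    [DecidableRel G.Adj]
    (hac : (SimpleGraph.induce {v | G.degree v = G.maxDegree} G).IsAcyclic)
    (t : ℕ) (ht : G.maxDegree < t)
    (f : Sym2 V → ℕ) (hf : IsProperEdgeColoring G t f) :
    ∃ g, IsProperEdgeColoring G G.maxDegree g ∧ KempeEquiv G t f g := by
  induction t, ht using Nat.le_induction generalizing f with
  | base => exact hf.exists_kempeEquiv_of_isAcyclic hac le_rfl
  | succ n hn ih =>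
    obtain ⟨g, hg, hfg⟩ := hf.exists_kempeEquiv_of_isAcyclic hac (by omega)
    obtain ⟨g', hg', hgg'⟩ := ih g hg
    exact ⟨g', hg', hfg.trans (hgg'.mono n.le_succ)⟩
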